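/- Let X be a topological space and let A and B be a-locally closed subsets of X. If A and B are a-separated (i.e., A ∩ a-cl(B) = ∅ and B ∩ a-cl(A) = ∅), then A ∪ B is a-locally closed. -/

import Mathlib

open Set Topology

/-- A set is regular open if it equals the interior of its closure. -/
def RegOpen {X : Type*} [TopologicalSpace X] (U : Set X) : Prop :=
  U = interior (closure U)

/-- The δ-interior of `A`: the union of all regular open sets contained in `A`. -/
def deltaInt {X : Type*} [TopologicalSpace X] (A : Set X) : Set X :=
  ⋃₀ {U : Set X | RegOpen U ∧ U ⊆ A}

/-- The δ-closure of `A`: the complement of the δ-interior of the complement. -/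
def deltaCl {X : Type*} [TopologicalSpace X] (A : Set X) : Set X :=
  (deltaInt Aᶜ)ᶜ

/-- `A` is a-open if `A ⊆ int(cl(δ-int A))`. -/
def AOpen {X : Type*} [TopologicalSpace X] (A : Set X) : Prop :=
  A ⊆ interior (closure (deltaInt A))

/-- `A` is a-closed if its complement is a-open. -/
def AClosed {X : Type*} [TopologicalSpace X] (A : Set X) : Prop :=
  AOpen Aᶜ

/-- `A` is a-locally closed if it is the intersection of an a-open and an a-closed set. -/
def ALocallyClosed {X : Type*} [TopologicalSpace X] (A : Set X) : Prop :=
  ∃ U V : Set X, AOpen U ∧ AClosed V ∧ A = U ∩ V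

/-- `A` is e-open if `A ⊆ cl(δ-int A) ∪ int(δ-cl A)`. -/
def EOpen {X : Type*} [TopologicalSpace X] (A : Set X) : Prop :=
  A ⊆ closure (deltaInt A) ∪ interior (deltaCl A)

/-- `A` is e-closed if its complement is e-open. -/
def EClosed {X : Type*} [TopologicalSpace X] (A : Set X) : Prop :=
  EOpen Aᶜ

/-- `A` is e-locally closed if it is the intersection of an e-open and an e-closed set. -/
def ELocallyClosed {X : Type*} [TopologicalSpace X] (A : Set X) : Prop :=
  ∃ U V : Set X, EOpen U ∧ EClosed V ∧ A = U ∩ V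

/-- The a-closure of `A`: the intersection of all a-closed supersets of `A`. -/
def aCl {X : Type*} [TopologicalSpace X] (A : Set X) : Set X :=
  ⋂₀ {F : Set X | AClosed F ∧ A ⊆ F}

/-- The a-interior of `A`: the union of all a-open subsets of `A`. -/
def aInt {X : Type*} [TopologicalSpace X] (A : Set X) : Set X :=
  ⋃₀ {U : Set X | AOpen U ∧ U ⊆ A}

/-- The e-closure of `A`: the intersection of all e-closed supersets of `A`. -/
def eCl {X : Type*} [TopologicalSpace X] (A : Set X) : Set X :=
  ⋂₀ {F : Set X | EClosed F ∧ A ⊆ F}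

/-- `S` is semi-open if `S ⊆ cl(int S)`. -/
def SemiOpen {X : Type*} [TopologicalSpace X] (S : Set X) : Prop :=
  S ⊆ closure (interior S)

/-- `S` is semi-closed if its complement is semi-open. -/
def SemiClosed {X : Type*} [TopologicalSpace X] (S : Set X) : Prop :=
  SemiOpen Sᶜ

/-- The semi-closure of `U`: the intersection of all semi-closed supersets of `U`. -/
def sCl {X : Type*} [TopologicalSpace X] (U : Set X) : Set X :=
  ⋂₀ {F : Set X | SemiClosed F ∧ U ⊆ F}

/-- `A` is feebly open if there is an open `U` with `U ⊆ A ⊆ scl(U)`. -/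
def FeeblyOpen {X : Type*} [TopologicalSpace X] (A : Set X) : Prop :=
  ∃ U : Set X, IsOpen U ∧ U ⊆ A ∧ A ⊆ sCl U

/-- `A` is feebly closed if its complement is feebly open. -/
def FeeblyClosed {X : Type*} [TopologicalSpace X] (A : Set X) : Prop :=
  FeeblyOpen Aᶜ

/-- `A` is feebly locally closed if it is the intersection of a feebly open and a
feebly closed set. -/
def FeeblyLocallyClosed {X : Type*} [TopologicalSpace X] (A : Set X) : Prop :=
  ∃ U V : Set X, FeeblyOpen U ∧ FeeblyClosed V ∧ A = U ∩ V

/-- `A` is α-open if `A ⊆ int(cl(int A))`. -/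
def AlphaOpen {X : Type*} [TopologicalSpace X] (A : Set X) : Prop :=
  A ⊆ interior (closure (interior A))

/-- `A` is α-closed if its complement is α-open. -/
def AlphaClosed {X : Type*} [TopologicalSpace X] (A : Set X) : Prop :=
  AlphaOpen Aᶜ

/-- `A` is α-locally closed if it is the intersection of an α-open and an α-closed set. -/
def AlphaLocallyClosed {X : Type*} [TopologicalSpace X] (A : Set X) : Prop :=
  ∃ U V : Set X, AlphaOpen U ∧ AlphaClosed V ∧ A = U ∩ V

/-- `X` is submaximal if every dense subset of `X` is open. -/
def Submaximal (X : Type*) [TopologicalSpace X] : Prop :=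
  ∀ A : Set X, closure A = univ → IsOpen A

/-- `X` is a-submaximal if every a-dense subset of `X` is a-open. -/
def ASubmaximal (X : Type*) [TopologicalSpace X] : Prop :=
  ∀ A : Set X, aCl A = univ → AOpen A

/-- `X` is e-submaximal if every e-dense subset of `X` is e-open. -/
def ESubmaximal (X : Type*) [TopologicalSpace X] : Prop :=
  ∀ A : Set X, eCl A = univ → EOpen A

/-- `X` is an e-space if a subset is open precisely when it is e-open. -/
def IsESpace (X : Type*) [TopologicalSpace X] : Prop :=
  ∀ A : Set X, IsOpen A ↔ EOpen A

theorem regOpen_inter_aux {X : Type*} [TopologicalSpace X] {U V : Set X}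
    (hU : RegOpen U) (hV : RegOpen V) : RegOpen (U ∩ V) := by
  unfold RegOpen at *
  have oU : IsOpen U := by rw [hU]; exact isOpen_interior
  have oV : IsOpen V := by rw [hV]; exact isOpen_interior
  apply Subset.antisymm
  · exact interior_maximal subset_closure (oU.inter oV)
  · intro x hx
    constructor
    · rw [hU]; exact interior_mono (closure_mono inter_subset_left) hx
    · rw [hV]; exact interior_mono (closure_mono inter_subset_right) hx

theorem deltaInt_isOpen_aux {X : Type*} [TopologicalSpace X] (A : Set X) :
    IsOpen (deltaInt A) := by
  apply isOpen_sUnion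
  rintro U ⟨hU, -⟩
  rw [hU]; exact isOpen_interior

theorem deltaInt_mono_aux {X : Type*} [TopologicalSpace X] {A B : Set X} (h : A ⊆ B) :
    deltaInt A ⊆ deltaInt B := by
  rintro x ⟨U, ⟨hU, hUA⟩, hx⟩
  exact ⟨U, ⟨hU, hUA.trans h⟩, hx⟩

theorem aOpen_inter_aux {X : Type*} [TopologicalSpace X] {A B : Set X}
    (hA : AOpen A) (hB : AOpen B) : AOpen (A ∩ B) := by
  have h1 : deltaInt A ∩ deltaInt B ⊆ deltaInt (A ∩ B) := by
    rintro x ⟨⟨U, ⟨hU, hUA⟩, hx⟩, ⟨V, ⟨hV, hVB⟩, hy⟩⟩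
    exact ⟨U ∩ V, ⟨regOpen_inter_aux hU hV, inter_subset_inter hUA hVB⟩, hx, hy⟩
  have h2 : interior (closure (deltaInt A)) ∩ interior (closure (deltaInt B)) ⊆
      closure (deltaInt A ∩ deltaInt B) := by
    rintro x ⟨hx, hy⟩
    rw [mem_closure_iff]
    intro O hO hxO
    obtain ⟨y, ⟨hyO, hyB⟩, hyA⟩ := mem_closure_iff.1 (interior_subset hx)
      (O ∩ interior (closure (deltaInt B))) (hO.inter isOpen_interior) ⟨hxO, hy⟩
    obtain ⟨z, ⟨hzO, hzA⟩, hzB⟩ := mem_closure_iff.1 (interior_subset hyB)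
      (O ∩ deltaInt A) (hO.inter (deltaInt_isOpen_aux A)) ⟨hyO, hyA⟩
    exact ⟨z, hzO, hzA, hzB⟩
  intro x hx
  exact interior_maximal (h2.trans (closure_mono h1)) (isOpen_interior.inter isOpen_interior)
    ⟨hA hx.1, hB hx.2⟩

theorem aOpen_sUnion_aux {X : Type*} [TopologicalSpace X] {S : Set (Set X)}
    (h : ∀ A ∈ S, AOpen A) : AOpen (⋃₀ S) := by
  rintro x ⟨A, hA, hx⟩
  exact interior_mono (closure_mono (deltaInt_mono_aux (subset_sUnion_of_mem hA))) (h A hA hx)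

theorem aOpen_union_aux {X : Type*} [TopologicalSpace X] {A B : Set X}
    (hA : AOpen A) (hB : AOpen B) : AOpen (A ∪ B) := by
  rw [← sUnion_pair]
  apply aOpen_sUnion_aux
  rintro C (rfl | rfl)
  · exact hA
  · exact hB

theorem aClosed_aCl_aux {X : Type*} [TopologicalSpace X] (A : Set X) : AClosed (aCl A) := by
  unfold AClosed aCl
  rw [compl_sInter]
  apply aOpen_sUnion_aux
  rintro _ ⟨F, hF, rfl⟩
  exact hF.1

theorem subset_aCl_aux {X : Type*} [TopologicalSpace X] (A : Set X) : A ⊆ aCl A :=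
  subset_sInter fun _ hF => hF.2

theorem aLocallyClosed_union_of_aSeparated {X : Type*} [TopologicalSpace X] (A B : Set X)
    (hA : ALocallyClosed A) (hB : ALocallyClosed B)
    (hAB : A ∩ aCl B = ∅) (hBA : B ∩ aCl A = ∅) : ALocallyClosed (A ∪ B) := by
  obtain ⟨U, F, hU, hF, hUF⟩ := hA
  obtain ⟨V, G, hV, hG, hVG⟩ := hB
  have hAF : aCl A ⊆ F := sInter_subset_of_mem ⟨hF, hUF ▸ inter_subset_right⟩
  have hBG : aCl B ⊆ G := sInter_subset_of_mem ⟨hG, hVG ▸ inter_subset_right⟩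
  refine ⟨(U ∩ (aCl B)ᶜ) ∪ (V ∩ (aCl A)ᶜ), aCl A ∪ aCl B,
    aOpen_union_aux (aOpen_inter_aux hU (aClosed_aCl_aux B))
      (aOpen_inter_aux hV (aClosed_aCl_aux A)), ?_, ?_⟩
  · unfold AClosed
    rw [compl_union]
    exact aOpen_inter_aux (aClosed_aCl_aux A) (aClosed_aCl_aux B)
  · ext x
    have a1 := @subset_aCl_aux X _ A x
    have b1 := @subset_aCl_aux X _ B x
    have a2 := @hAF x
    have b2 := @hBG x
    have a3 : x ∈ A ↔ x ∈ U ∧ x ∈ F := by rw [hUF]; rfl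
    have b3 : x ∈ B ↔ x ∈ V ∧ x ∈ G := by rw [hVG]; rfl
    have a4 : ¬ (x ∈ A ∧ x ∈ aCl B) := fun h => (hAB ▸ h : x ∈ (∅ : Set X))
    have b4 : ¬ (x ∈ B ∧ x ∈ aCl A) := fun h => (hBA ▸ h : x ∈ (∅ : Set X))
    simp only [mem_union, mem_inter_iff, mem_compl_iff]
    clear hUF hVG hAB hBA
    grind
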